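/- arXiv:1906.05014 — 2 statements merged into one kernel-verified Lean document; each statement's English description precedes it below -/
import Mathlib

section
/- Let d be a positive integer and let κ, L, h > 0. Let ψ : ℝ^d → ℝ be twice continuously differentiable with operator norm ‖∇²ψ(u)‖ ≤ L for every u ∈ ℝ^d, and fix z_j ∈ ℝ^d. Define f : ℝ^d → ℝ^{d+1} by f(z) = (z, (h²/(κL))·ψ((z − z_j)/h)). For z₀ ∈ ℝ^d set g = ∇ψ((z₀ − z_j)/h), C = √(1 + (h/(κL))²·‖g‖²), and let ν(z₀) = C^{-1}·(−(h/(κL))·g, 1) ∈ ℝ^{d+1}. Then for every z ∈ ℝ^d one has |⟨ν(z₀), f(z) − f(z₀)⟩| ≤ ‖z − z₀‖²/(2κ). -/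
open scoped RealInnerProductSpace

/-- A function with norm-bounded second derivative has Lipschitz first derivative. -/
theorem norm_fderiv_sub_le_of_norm_iteratedFDeriv_two_le {E F : Type*}
    [NormedAddCommGroup E] [NormedSpace ℝ E] [NormedAddCommGroup F] [NormedSpace ℝ F]
    {ψ : E → F} {L : ℝ} (hψ : ContDiff ℝ 2 ψ) (hL : ∀ u, ‖iteratedFDeriv ℝ 2 ψ u‖ ≤ L)
    (x y : E) : ‖fderiv ℝ ψ y - fderiv ℝ ψ x‖ ≤ L * ‖y - x‖ := by
  have hdiff : Differentiable ℝ (fderiv ℝ ψ) :=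
    (hψ.fderiv_right (m := 1) (by norm_num)).differentiable one_ne_zero
  refine convex_univ.norm_image_sub_le_of_norm_fderiv_le (𝕜 := ℝ) (fun u _ => hdiff u)
    (fun u _ => ?_) (Set.mem_univ x) (Set.mem_univ y)
  rw [← norm_iteratedFDeriv_one, norm_iteratedFDeriv_fderiv]
  exact hL u

/-- First-order Taylor estimate for a function with norm-bounded second derivative. -/
theorem norm_sub_sub_fderiv_le_of_norm_iteratedFDeriv_two_le {E F : Type*}
    [NormedAddCommGroup E] [NormedSpace ℝ E] [NormedAddCommGroup F] [NormedSpace ℝ F]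
    {ψ : E → F} {L : ℝ} (hψ : ContDiff ℝ 2 ψ) (hL : ∀ u, ‖iteratedFDeriv ℝ 2 ψ u‖ ≤ L)
    (x y : E) : ‖ψ y - ψ x - fderiv ℝ ψ x (y - x)‖ ≤ L / 2 * ‖y - x‖ ^ 2 := by
  set v := y - x with hv
  have hremainder (t : ℝ) : HasDerivAt (fun s : ℝ => ψ (x + s • v) - ψ x - s • fderiv ℝ ψ x v)
      (fderiv ℝ ψ (x + t • v) v - fderiv ℝ ψ x v) t := by
    have hline : HasDerivAt (fun s : ℝ => x + s • v) v t := by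
      simpa using ((hasDerivAt_id t).smul_const v).const_add x
    have hcomp := ((hψ.differentiable two_ne_zero) (x + t • v)).hasFDerivAt.comp_hasDerivAt t hline
    have hlin : HasDerivAt (fun s : ℝ => s • fderiv ℝ ψ x v) (fderiv ℝ ψ x v) t := by
      simpa using (hasDerivAt_id t).smul_const (fderiv ℝ ψ x v)
    exact (hcomp.sub_const (ψ x)).sub hlin
  have hbound (t : ℝ) : HasDerivAt (fun s : ℝ => L / 2 * ‖v‖ ^ 2 * s ^ 2) (L * ‖v‖ ^ 2 * t) t := by
    refine ((hasDerivAt_pow 2 t).const_mul (L / 2 * ‖v‖ ^ 2)).congr_deriv ?_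
    norm_num
    ring
  have key := image_norm_le_of_norm_deriv_right_le_deriv_boundary (a := (0 : ℝ)) (b := 1)
    (fun t _ => (hremainder t).continuousAt.continuousWithinAt)
    (fun t _ => (hremainder t).hasDerivWithinAt) (by simp) hbound
    (fun t ht => by
      have hlip := norm_fderiv_sub_le_of_norm_iteratedFDeriv_two_le hψ hL x (x + t • v)
      rw [add_sub_cancel_left, norm_smul, Real.norm_of_nonneg ht.1] at hlip
      calc ‖fderiv ℝ ψ (x + t • v) v - fderiv ℝ ψ x v‖
          ≤ ‖fderiv ℝ ψ (x + t • v) - fderiv ℝ ψ x‖ * ‖v‖ :=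
            (fderiv ℝ ψ (x + t • v) - fderiv ℝ ψ x).le_opNorm v
        _ ≤ L * (t * ‖v‖) * ‖v‖ := by gcongr
        _ = L * ‖v‖ ^ 2 * t := by ring)
    (Set.right_mem_Icc.mpr zero_le_one)
  simpa [hv] using key

/-- Key inequality in the proof of Theorem 3 (lower bound): the bump graph
`f(z) = (z, (h²/(κL))·ψ((z − z_j)/h))` satisfies Federer's reach-`κ` criterion
`|⟨ν(z₀), f(z) − f(z₀)⟩| ≤ ‖z − z₀‖²/(2κ)`, where `ν(z₀)` is the unit normal at `f(z₀)`. -/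
theorem stmt_11 (d : ℕ) (hd : 0 < d) (κ L h : ℝ) (hκ : 0 < κ) (hL : 0 < L) (hh : 0 < h)
    (ψ : EuclideanSpace ℝ (Fin d) → ℝ) (hψ : ContDiff ℝ 2 ψ)
    (hHess : ∀ u : EuclideanSpace ℝ (Fin d), ‖iteratedFDeriv ℝ 2 ψ u‖ ≤ L)
    (zj z₀ z : EuclideanSpace ℝ (Fin d))
    (f : EuclideanSpace ℝ (Fin d) → WithLp 2 (EuclideanSpace ℝ (Fin d) × ℝ))
    (hf : ∀ w, f w = (WithLp.equiv 2 (EuclideanSpace ℝ (Fin d) × ℝ)).symm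
      (w, h ^ 2 / (κ * L) * ψ (h⁻¹ • (w - zj))))
    (g : EuclideanSpace ℝ (Fin d)) (hg : g = gradient ψ (h⁻¹ • (z₀ - zj)))
    (C : ℝ) (hC : C = Real.sqrt (1 + (h / (κ * L)) ^ 2 * ‖g‖ ^ 2))
    (ν : WithLp 2 (EuclideanSpace ℝ (Fin d) × ℝ))
    (hν : ν = C⁻¹ • (WithLp.equiv 2 (EuclideanSpace ℝ (Fin d) × ℝ)).symm
      (-(h / (κ * L)) • g, 1)) :
    |⟪ν, f z - f z₀⟫| ≤ ‖z - z₀‖ ^ 2 / (2 * κ) := by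
  have hC1 : 1 ≤ C := by
    rw [hC]
    exact Real.one_le_sqrt.mpr (le_add_of_nonneg_right (by positivity))
  set x := h⁻¹ • (z₀ - zj) with hx
  set y := h⁻¹ • (z - zj) with hy
  have hyx : y - x = h⁻¹ • (z - z₀) := by
    rw [hx, hy, ← smul_sub, sub_sub_sub_cancel_right]
  have htaylor := norm_sub_sub_fderiv_le_of_norm_iteratedFDeriv_two_le hψ hHess x y
  have hgrad : fderiv ℝ ψ x (y - x) = h⁻¹ * ⟪g, z - z₀⟫ := by
    rw [hyx, map_smul, smul_eq_mul, hg, gradient, InnerProductSpace.toDual_symm_apply]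
  have hinner : ⟪ν, f z - f z₀⟫ =
      C⁻¹ * (h ^ 2 / (κ * L) * (ψ y - ψ x - fderiv ℝ ψ x (y - x))) := by
    rw [hgrad, hν, hf, hf, real_inner_smul_left, WithLp.prod_inner_apply]
    congr 1
    simp only [WithLp.equiv_symm_apply, real_inner_smul_left, RCLike.inner_apply, ← hx, ← hy,
      WithLp.ofLp_sub, Prod.fst_sub, Prod.snd_sub, map_one, mul_one]
    field_simp
    ring
  rw [hyx, norm_smul, norm_inv, Real.norm_of_nonneg hh.le, Real.norm_eq_abs, ← hyx] at htaylor
  rw [hinner, abs_mul, abs_mul, abs_of_nonneg (by positivity : 0 ≤ C⁻¹),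
    abs_of_nonneg (by positivity : 0 ≤ h ^ 2 / (κ * L))]
  calc C⁻¹ * (h ^ 2 / (κ * L) * |ψ y - ψ x - fderiv ℝ ψ x (y - x)|)
      ≤ 1 * (h ^ 2 / (κ * L) * (L / 2 * (h⁻¹ * ‖z - z₀‖) ^ 2)) := by
        gcongr
        exact inv_le_one_of_one_le₀ hC1
    _ = ‖z - z₀‖ ^ 2 / (2 * κ) := by
        field_simp
end

section
/- Let d be a positive integer, h > 0, r ≥ 0, and let u ∈ ℝ^d with ‖u‖ ≤ 1. Let W ⊆ ℝ^d be a measurable set containing the closed ball B̄(0, r). Then |∫_W exp(−‖v‖²/h²)·⟨u, v⟩ dv| ≤ ∫_{{v : ‖v‖ > r}} exp(−‖v‖²/h²)·‖v‖ dv, where the integrals are with respect to Lebesgue measure on ℝ^d, ‖·‖ is the Euclidean norm and ⟨·,·⟩ the Euclidean inner product. -/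
open scoped RealInnerProductSpace

open MeasureTheory Module

section GaussianWeight

variable {E : Type*} [NormedAddCommGroup E] [InnerProductSpace ℝ E] [FiniteDimensional ℝ E]
  [MeasurableSpace E] [BorelSpace E]

/-- The norm is integrable against a Gaussian weight. -/
theorem integrable_exp_neg_norm_sq_div_mul_norm [Nontrivial E] {h : ℝ} (hh : 0 < h) :
    Integrable (fun v : E => Real.exp (-‖v‖ ^ 2 / h ^ 2) * ‖v‖) := by
  rw [integrable_fun_norm_addHaar volume (f := fun y : ℝ => Real.exp (-y ^ 2 / h ^ 2) * y)]
  have key := integrable_rpow_mul_exp_neg_mul_sq (b := 1 / h ^ 2) (by positivity)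
    (s := (finrank ℝ E : ℝ)) (by linarith [(finrank ℝ E).cast_nonneg (α := ℝ)])
  refine key.integrableOn.congr_fun (fun y _ => ?_) measurableSet_Ioi
  have hpow : y ^ finrank ℝ E = y ^ (finrank ℝ E - 1) * y :=
    (pow_sub_one_mul finrank_pos.ne' y).symm
  simp only [Real.rpow_natCast, smul_eq_mul]
  rw [hpow, show -(1 / h ^ 2) * y ^ 2 = -y ^ 2 / h ^ 2 by ring]
  ring

/-- A linear functional is integrable against a Gaussian weight. -/
theorem integrable_exp_neg_norm_sq_div_mul_inner [Nontrivial E] {h : ℝ} (hh : 0 < h) (u : E) :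
    Integrable (fun v : E => Real.exp (-‖v‖ ^ 2 / h ^ 2) * ⟪u, v⟫) := by
  refine ((integrable_exp_neg_norm_sq_div_mul_norm hh).const_mul ‖u‖).mono'
    (by fun_prop) (.of_forall fun v => ?_)
  rw [norm_mul, Real.norm_of_nonneg (Real.exp_nonneg _), mul_left_comm]
  gcongr
  exact norm_inner_le_norm u v

/-- A linear functional integrates to zero against a Gaussian weight, by symmetry. -/
theorem integral_exp_neg_norm_sq_div_mul_inner (h : ℝ) (u : E) :
    ∫ v : E, Real.exp (-‖v‖ ^ 2 / h ^ 2) * ⟪u, v⟫ = 0 := by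
  have hneg := integral_neg_eq_self (fun v : E => Real.exp (-‖v‖ ^ 2 / h ^ 2) * ⟪u, v⟫) volume
  simp only [norm_neg, inner_neg_right, mul_neg, integral_neg] at hneg
  linarith

end GaussianWeight

/-- Cancellation bound from the proof of Lemma 5: if the measurable set `W` contains the
closed ball of radius `r`, then
`|∫_W e^{−‖v‖²/h²} ⟨u,v⟩ dv| ≤ ∫_{‖v‖ > r} e^{−‖v‖²/h²} ‖v‖ dv`. -/
theorem stmt_17 (d : ℕ) (hd : 0 < d) (h r : ℝ) (hh : 0 < h) (hr : 0 ≤ r)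
    (u : EuclideanSpace ℝ (Fin d)) (hu : ‖u‖ ≤ 1)
    (W : Set (EuclideanSpace ℝ (Fin d))) (hWmeas : MeasurableSet W)
    (hW : Metric.closedBall (0 : EuclideanSpace ℝ (Fin d)) r ⊆ W) :
    |∫ v in W, Real.exp (-‖v‖ ^ 2 / h ^ 2) * ⟪u, v⟫| ≤
      ∫ v in {v : EuclideanSpace ℝ (Fin d) | r < ‖v‖},
        Real.exp (-‖v‖ ^ 2 / h ^ 2) * ‖v‖ := by
  have : Nonempty (Fin d) := ⟨⟨0, hd⟩⟩
  have hnorm := integrable_exp_neg_norm_sq_div_mul_norm (E := EuclideanSpace ℝ (Fin d)) hh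
  have hsplit := integral_add_compl hWmeas (integrable_exp_neg_norm_sq_div_mul_inner hh u)
  rw [integral_exp_neg_norm_sq_div_mul_inner] at hsplit
  rw [eq_neg_of_add_eq_zero_left hsplit, abs_neg, ← Real.norm_eq_abs]
  have hsub : Wᶜ ⊆ {v : EuclideanSpace ℝ (Fin d) | r < ‖v‖} := fun v hv =>
    not_le.mp fun hle => hv (hW (mem_closedBall_zero_iff.mpr hle))
  calc ‖∫ v in Wᶜ, Real.exp (-‖v‖ ^ 2 / h ^ 2) * ⟪u, v⟫‖
      ≤ ∫ v in Wᶜ, Real.exp (-‖v‖ ^ 2 / h ^ 2) * ‖v‖ := by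
        refine norm_integral_le_of_norm_le hnorm.integrableOn (.of_forall fun v => ?_)
        rw [norm_mul, Real.norm_of_nonneg (Real.exp_nonneg _)]
        gcongr
        exact (norm_inner_le_norm u v).trans (mul_le_of_le_one_left (norm_nonneg v) hu)
    _ ≤ _ := setIntegral_mono_set hnorm.integrableOn
        (.of_forall fun v => by positivity) hsub.eventuallyLE
end
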